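/- Let M = ⟨P,Δ,τ⟩, D(M) and h̄ be as defined. Then for every word w ∈ Δ* and every state p ∈ P∖{s}: reading h̄(w) in D(M) from the state (p,1) leads to the state (τ(p,w),1) if τ(p,w) ≠ s, and to the sink ζ if τ(p,w) = s. Consequently, for every w ∈ Δ*, if h̄(w) is a reset word for D(M), then w is a reset word for M. -/

import Mathlib

/-- The transition function of a DFA extended to words (read left to right). -/
def deltaStar {Q A : Type} (δ : Q → A → Q) (q : Q) (w : List A) : Q :=
  w.foldl δ q

/-- `w` is a reset word for the DFA with transition function `δ`. -/
def IsReset {Q A : Type} (δ : Q → A → Q) (w : List A) : Prop :=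
  ∀ q q' : Q, deltaStar δ q w = deltaStar δ q' w

/-- The set of reset words of a DFA. -/
def Syn {Q A : Type} (δ : Q → A → Q) : Set (List A) :=
  {w | IsReset δ w}

/-- The alphabet Δ = Σ ∪ {x,y,z}: `Sum.inl a` is a letter of Σ, and
`Sum.inr 0`, `Sum.inr 1`, `Sum.inr 2` are the new letters x, y, z. -/
abbrev Alph (σ : Type) : Type := σ ⊕ Fin 3

def xL {σ : Type} : Alph σ := Sum.inr 0
def yL {σ : Type} : Alph σ := Sum.inr 1
def zL {σ : Type} : Alph σ := Sum.inr 2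

/-- The states of the binary DFA D(M): pairs (p,k) with p ∈ P∖{s} and k ∈ Fin 5
(the five rows, 0-indexed), plus the sink ζ represented by `none`. -/
abbrev DSt (P : Type) (s : P) : Type := Option ({p : P // p ≠ s} × Fin 5)

/-- The letters of D(M): `false` is μ and `true` is λ. -/
abbrev BinL : Type := Bool

/-- The transition function τ₂ of the binary DFA D(M) built from the DFA
M = ⟨P, Fin 5, τ⟩ with sink state s. -/
def tau2 {P : Type} [DecidableEq P] (τ : P → Fin 5 → P) (s : P) :
    DSt P s → BinL → DSt P s
  | none, _ => none
  | some (p, k), false => some (p, if k.val < 4 then k + 1 else k)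
  | some (p, k), true =>
      if h : τ p.1 k = s then none else some (⟨τ p.1 k, h⟩, 0)

/-- The morphism h̄ : Δ* → {λ,μ}*λ, sending the k-th letter d_k of the
five-letter alphabet Δ = Fin 5 (0-indexed) to μ^k λ. -/
def hbar (w : List (Fin 5)) : List BinL :=
  (w.map fun k => List.replicate k.val false ++ [true]).flatten

theorem deltaStar_append {Q A : Type} (δ : Q → A → Q) (q : Q) (u v : List A) :
    deltaStar δ q (u ++ v) = deltaStar δ (deltaStar δ q u) v :=
  List.foldl_append

/-- A state fixed by every letter is fixed by every word. -/
theorem deltaStar_of_sink {Q A : Type} {δ : Q → A → Q} {q : Q} (hq : ∀ a, δ q a = q)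
    (w : List A) : deltaStar δ q w = q :=
  List.foldl_fixed' hq w

theorem hbar_cons (k : Fin 5) (w : List (Fin 5)) :
    hbar (k :: w) = (List.replicate k.val false ++ [true]) ++ hbar w := by
  simp [hbar]

section BinaryDFA

variable {P : Type} [DecidableEq P] (τ : P → Fin 5 → P) (s : P)

theorem deltaStar_tau2_none (w : List BinL) : deltaStar (tau2 τ s) none w = none :=
  deltaStar_of_sink (fun _ => rfl) w

theorem deltaStar_tau2_hbar_letter (p : {p : P // p ≠ s}) (k : Fin 5) :
    deltaStar (tau2 τ s) (some (p, 0)) (List.replicate k.val false ++ [true]) =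
      if h : τ p.1 k = s then none else some (⟨τ p.1 k, h⟩, 0) := by
  fin_cases k <;> rfl

theorem deltaStar_tau2_hbar (hs : ∀ d, τ s d = s) (w : List (Fin 5)) (p : {p : P // p ≠ s}) :
    deltaStar (tau2 τ s) (some (p, 0)) (hbar w) =
      if h : deltaStar τ p.1 w = s then none else some (⟨deltaStar τ p.1 w, h⟩, 0) := by
  induction w generalizing p with
  | nil => simp [deltaStar, hbar, p.2]
  | cons k w ih =>
    rw [hbar_cons, deltaStar_append, deltaStar_tau2_hbar_letter]
    by_cases hk : τ p.1 k = s
    · have hw : deltaStar τ p.1 (k :: w) = s := by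
        change deltaStar τ (τ p.1 k) w = s
        rw [hk, deltaStar_of_sink hs]
      rw [dif_pos hk, dif_pos hw, deltaStar_tau2_none]
    · rw [dif_neg hk]
      exact ih ⟨τ p.1 k, hk⟩

end BinaryDFA

/-- Reading h̄(w) in D(M) from (p,1) leads to (τ(p,w),1) if τ(p,w) ≠ s and to
the sink ζ if τ(p,w) = s; consequently, if h̄(w) is a reset word for D(M) then
w is a reset word for M. -/
theorem hbar_simulation
    (P : Type) [DecidableEq P] [Fintype P] (τ : P → Fin 5 → P) (s : P)
    (hs : ∀ d : Fin 5, τ s d = s) :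
    (∀ (w : List (Fin 5)) (p : {p : P // p ≠ s}),
        deltaStar (tau2 τ s) (some (p, (0 : Fin 5))) (hbar w) =
          if h : deltaStar τ p.1 w = s then none
          else some (⟨deltaStar τ p.1 w, h⟩, (0 : Fin 5))) ∧
    (∀ w : List (Fin 5), IsReset (tau2 τ s) (hbar w) → IsReset τ w) := by
  have sim := deltaStar_tau2_hbar τ s hs
  refine ⟨sim, fun w hw => ?_⟩
  have to_sink (q : P) : deltaStar τ q w = s := by
    by_cases hq : q = s
    · rw [hq, deltaStar_of_sink hs]
    · by_contra hne
      have h := hw (some (⟨q, hq⟩, 0)) none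
      rw [sim, deltaStar_tau2_none, dif_neg hne] at h
      exact Option.some_ne_none _ h
  exact fun q q' => (to_sink q).trans (to_sink q').symm
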